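/- (LES form of the LAMHD-α nonlinearity.) Let α be a real number and let u_s, B_s : ℝ³ → ℝ³ be smooth vector fields with div u_s = 0 and div B_s = 0 everywhere; set u = (1−α²Δ)u_s and B = (1−α²Δ)B_s. Define the matrix field τ = ( ∇u_s·∇u_s + ∇u_s·(∇u_s)ᵀ − (∇u_s)ᵀ·∇u_s ) − ( ∇B_s·∇B_s + ∇B_s·(∇B_s)ᵀ − (∇B_s)ᵀ·∇B_s ) and the scalar field Φ = ½|u_s|² + (α²/2)|∇u_s|² + ½(1−α²Δ)|B_s|² + (α²/2)|∇B_s|². Then at every point of ℝ³, (u_s·∇)u − (B_s·∇)B + (∇u_s)ᵀ·u + (∇B)ᵀ·B_s = (1−α²Δ)( (u_s·∇)u_s − (B_s·∇)B_s ) + α² div τ + ∇Φ. -/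

import Mathlib

open Matrix MeasureTheory

noncomputable section

abbrev V3 := Fin 3 → ℝ

/-- Partial derivative `∂_j f` of a scalar field on ℝ³. -/
def pd (j : Fin 3) (f : V3 → ℝ) (x : V3) : ℝ := fderiv ℝ f x (Pi.single j 1)

/-- Jacobian matrix field: `(∇f)_{ij} = ∂f_i/∂x_j`. -/
def grad (f : V3 → V3) (x : V3) : Matrix (Fin 3) (Fin 3) ℝ :=
  Matrix.of fun i j => pd j (fun y => f y i) x

/-- Divergence of a vector field. -/
def divV (f : V3 → V3) (x : V3) : ℝ := ∑ j, pd j (fun y => f y j) x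

/-- Divergence of a matrix field: `(div M)_i = Σ_j ∂_j M_{ij}`. -/
def divM (M : V3 → Matrix (Fin 3) (Fin 3) ℝ) (x : V3) (i : Fin 3) : ℝ :=
  ∑ j, pd j (fun y => M y i j) x

/-- Scalar Laplacian. -/
def lapS (φ : V3 → ℝ) (x : V3) : ℝ := ∑ j, pd j (fun y => pd j φ y) x

/-- Componentwise Laplacian of a vector field. -/
def lap (f : V3 → V3) (x : V3) (i : Fin 3) : ℝ := lapS (fun y => f y i) x

/-- Helmholtz operator `(1 - α²Δ)` on vector fields. -/
def helm (α : ℝ) (f : V3 → V3) (x : V3) (i : Fin 3) : ℝ := f x i - α ^ 2 * lap f x i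

/-- Helmholtz operator `(1 - α²Δ)` on scalar fields. -/
def helmS (α : ℝ) (φ : V3 → ℝ) (x : V3) : ℝ := φ x - α ^ 2 * lapS φ x

/-- Advection `(g·∇)f = Σ_j g_j ∂_j f`. -/
def advect (g f : V3 → V3) (x : V3) (i : Fin 3) : ℝ :=
  ∑ j, g x j * pd j (fun y => f y i) x

/-- `(∇f)ᵀ·g`, pointwise matrix-vector product. -/
def gradTvec (f g : V3 → V3) (x : V3) (i : Fin 3) : ℝ :=
  ∑ j, (grad f x)ᵀ i j * g x j

/-- Gradient of a scalar field. -/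
def gradS (φ : V3 → ℝ) (x : V3) (i : Fin 3) : ℝ := pd i φ x

/-- Pointwise squared Euclidean norm `|f|²`. -/
def normSq (f : V3 → V3) (x : V3) : ℝ := ∑ i, (f x i) ^ 2

/-- Squared Frobenius norm of the Jacobian, `|∇f|²`. -/
def gradNormSq (f : V3 → V3) (x : V3) : ℝ := ∑ i, ∑ j, (grad f x i j) ^ 2

/-- Partial derivatives of smooth scalar fields are smooth. -/
@[fun_prop]
theorem contDiff_pd {f : V3 → ℝ} (j : Fin 3) (hf : ContDiff ℝ (⊤ : ℕ∞) f) :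
    ContDiff ℝ (⊤ : ℕ∞) (pd j f) := by
  have h : ContDiff ℝ (⊤ : ℕ∞) (fderiv ℝ f) := hf.fderiv_right (by simp)
  exact h.clm_apply contDiff_const

theorem differentiableAt_of_smooth {f : V3 → ℝ} (hf : ContDiff ℝ (⊤ : ℕ∞) f) (x : V3) :
    DifferentiableAt ℝ f x :=
  hf.differentiable (by simp) x

theorem pd_add {f g : V3 → ℝ} (j : Fin 3) (hf : ContDiff ℝ (⊤ : ℕ∞) f)
    (hg : ContDiff ℝ (⊤ : ℕ∞) g) :
    pd j (fun y => f y + g y) = fun y => pd j f y + pd j g y := by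
  funext x
  simp [pd, fderiv_fun_add (differentiableAt_of_smooth hf x) (differentiableAt_of_smooth hg x)]

theorem pd_sub {f g : V3 → ℝ} (j : Fin 3) (hf : ContDiff ℝ (⊤ : ℕ∞) f)
    (hg : ContDiff ℝ (⊤ : ℕ∞) g) :
    pd j (fun y => f y - g y) = fun y => pd j f y - pd j g y := by
  funext x
  simp [pd, fderiv_fun_sub (differentiableAt_of_smooth hf x) (differentiableAt_of_smooth hg x)]

theorem pd_mul {f g : V3 → ℝ} (j : Fin 3) (hf : ContDiff ℝ (⊤ : ℕ∞) f)
    (hg : ContDiff ℝ (⊤ : ℕ∞) g) :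
    pd j (fun y => f y * g y) = fun y => f y * pd j g y + g y * pd j f y := by
  funext x
  simp [pd, fderiv_fun_mul (differentiableAt_of_smooth hf x) (differentiableAt_of_smooth hg x)]

theorem pd_const (j : Fin 3) (c : ℝ) : pd j (fun _ => c) = fun _ => 0 := by
  funext x
  simp [pd]

/-- Mixed partial derivatives of a smooth scalar field commute. -/
theorem pd_comm {f : V3 → ℝ} (i j : Fin 3) (hf : ContDiff ℝ (⊤ : ℕ∞) f) :
    pd i (pd j f) = pd j (pd i f) := by
  funext x
  have h : ContDiff ℝ (⊤ : ℕ∞) (fderiv ℝ f) := hf.fderiv_right (by simp)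
  have key : ∀ k l : Fin 3, pd k (pd l f) x
      = fderiv ℝ (fderiv ℝ f) x (Pi.single k 1) (Pi.single l 1) := by
    intro k l
    have e : pd l f = fun y => fderiv ℝ f y (Pi.single l 1) := rfl
    rw [e, pd, fderiv_clm_apply (h.differentiable (by simp) x) (by fun_prop)]
    simp
  rw [key, key]
  exact (hf.contDiffAt.isSymmSndFDerivAt (by
    simpa using WithTop.coe_le_coe.2 (le_top : (2 : ℕ∞) ≤ ⊤))).eq _ _

/-- Every partial derivative of the divergence of a solenoidal field vanishes. -/
theorem pd_divV_eq_zero {f : V3 → V3} (hf : ∀ k, ContDiff ℝ (⊤ : ℕ∞) fun y => f y k)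
    (hdiv : ∀ x, divV f x = 0) (k : Fin 3) (x : V3) :
    ∑ j, pd k (pd j fun y => f y j) x = 0 := by
  have h : pd k (divV f) x = 0 := by
    rw [show divV f = fun _ => 0 from funext hdiv]
    simp [pd]
  have h0 := hf 0
  have h1 := hf 1
  have h2 := hf 2
  have e : divV f = fun y => pd 0 (fun z => f z 0) y + pd 1 (fun z => f z 1) y
      + pd 2 (fun z => f z 2) y := by
    funext y
    simp [divV, Fin.sum_univ_three]
  rw [e] at h
  simpa (disch := fun_prop) only [pd_add, Fin.sum_univ_three] using h

set_option maxHeartbeats 4000000 in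
/-- LES form of the LAMHD-α nonlinearity. -/
theorem lamhd_les_form (α : ℝ) (us Bs : V3 → V3)
    (hus : ContDiff ℝ (⊤ : ℕ∞) us) (hBs : ContDiff ℝ (⊤ : ℕ∞) Bs)
    (hdivu : ∀ x : V3, divV us x = 0) (hdivB : ∀ x : V3, divV Bs x = 0) :
    ∀ x : V3, ∀ i : Fin 3,
      advect us (helm α us) x i - advect Bs (helm α Bs) x i
          + gradTvec us (helm α us) x i + gradTvec (helm α Bs) Bs x i
        = helm α (fun y j => advect us us y j - advect Bs Bs y j) x i
          + α ^ 2 * divM (fun y =>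
              (grad us y * grad us y + grad us y * (grad us y)ᵀ - (grad us y)ᵀ * grad us y)
              - (grad Bs y * grad Bs y + grad Bs y * (grad Bs y)ᵀ - (grad Bs y)ᵀ * grad Bs y)) x i
          + gradS (fun y => (1 / 2) * normSq us y + (α ^ 2 / 2) * gradNormSq us y
              + (1 / 2) * helmS α (normSq Bs) y + (α ^ 2 / 2) * gradNormSq Bs y) x i := by
  intro x i
  obtain ⟨v, rfl⟩ : ∃ v : Fin 3 → V3 → ℝ, us = fun y k => v k y := ⟨fun k y => us y k, rfl⟩
  obtain ⟨b, rfl⟩ : ∃ b : Fin 3 → V3 → ℝ, Bs = fun y k => b k y := ⟨fun k y => Bs y k, rfl⟩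
  have hv : ∀ k, ContDiff ℝ (⊤ : ℕ∞) (v k) := fun k => contDiff_pi.mp hus k
  have hb : ∀ k, ContDiff ℝ (⊤ : ℕ∞) (b k) := fun k => contDiff_pi.mp hBs k
  have dv := fun k => pd_divV_eq_zero hv hdivu k x
  have db := fun k => pd_divV_eq_zero hb hdivB k x
  clear hus hBs hdivu hdivB
  have h10 : ∀ f : V3 → ℝ, ContDiff ℝ (⊤ : ℕ∞) f → pd 1 (pd 0 f) = pd 0 (pd 1 f) :=
    fun f hf => pd_comm _ _ hf
  have h20 : ∀ f : V3 → ℝ, ContDiff ℝ (⊤ : ℕ∞) f → pd 2 (pd 0 f) = pd 0 (pd 2 f) :=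
    fun f hf => pd_comm _ _ hf
  have h21 : ∀ f : V3 → ℝ, ContDiff ℝ (⊤ : ℕ∞) f → pd 2 (pd 1 f) = pd 1 (pd 2 f) :=
    fun f hf => pd_comm _ _ hf
  simp only [Fin.sum_univ_three] at dv db
  have normSq_eq : normSq (fun y k => b k y)
      = fun y => b 0 y * b 0 y + b 1 y * b 1 y + b 2 y * b 2 y := by
    funext y
    simp [normSq, Fin.sum_univ_three, pow_two]
  simp only [advect, gradTvec, helm, helmS, lap, lapS, divM, gradS, normSq_eq, gradNormSq, grad,
    Matrix.transpose_apply, Matrix.of_apply, Matrix.sub_apply, Matrix.add_apply,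
    Matrix.mul_apply, Fin.sum_univ_three, pow_two]
  simp only [normSq, Fin.sum_univ_three, pow_two]
  eta_reduce at *
  generalize α * α = a
  have dv0 := dv 0
  have dv1 := dv 1
  have dv2 := dv 2
  have db0 := db 0
  have db1 := db 1
  have db2 := db 2
  simp (disch := fun_prop) only [h10, h20, h21] at dv0 dv1 dv2 db0 db1 db2
  fin_cases i
  all_goals
    simp (disch := fun_prop) only [Fin.zero_eta, Fin.mk_one, Fin.reduceFinMk, pd_add, pd_sub,
      pd_mul, pd_const]
    simp (disch := fun_prop) only [h10, h20, h21]
  · linear_combination (-a) * (pd 0 (v 0) x * dv0 + pd 1 (v 0) x * dv1 + pd 2 (v 0) x * dv2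
      - pd 0 (b 0) x * db0 - pd 1 (b 0) x * db1 - pd 2 (b 0) x * db2)
  · linear_combination (-a) * (pd 0 (v 1) x * dv0 + pd 1 (v 1) x * dv1 + pd 2 (v 1) x * dv2
      - pd 0 (b 1) x * db0 - pd 1 (b 1) x * db1 - pd 2 (b 1) x * db2)
  · linear_combination (-a) * (pd 0 (v 2) x * dv0 + pd 1 (v 2) x * dv1 + pd 2 (v 2) x * dv2
      - pd 0 (b 2) x * db0 - pd 1 (b 2) x * db1 - pd 2 (b 2) x * db2)
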